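/- (Tail bounds of return times for random LSV maps.) Assume esssup_ω β(ω) < 1 and b₀ = ℙ(β(ω) ≤ γ) > 0. Then there is a constant C > 0, depending only on the random dynamical system, such that for any ε ∈ (0,1/2), ℙ-a.e. ω ∈ Ω and every n ≥ 1: (i) μ_ω(τ_ω ≥ n) ≤ C (N_ε(ω) + 1)^{max(1, 1/γ − 1)} n^{1 − 1/γ}; and (ii) m̃(τ_ω ≥ n) ≤ C (S_n^σ(ω))^{−1/γ}. -/

import Mathlib

open MeasureTheory Filter Set
open scoped ENNReal NNReal

noncomputable section

/-- The Lipschitz norm of a real-valued function on a metric space: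
sup norm plus the best Lipschitz constant (junk values if unbounded). -/
noncomputable def lipNorm {M : Type*} [MetricSpace M] (g : M → ℝ) : ℝ :=
  (⨆ x, |g x|) +
    ⨆ p : {q : M × M // q.1 ≠ q.2}, |g (p : M × M).1 - g (p : M × M).2| / dist (p : M × M).1 (p : M × M).2

/-- `g` is Lipschitz (with some constant). -/
def IsLip {M : Type*} [MetricSpace M] (g : M → ℝ) : Prop :=
  ∃ c : NNReal, LipschitzWith c g

/-- Fiberwise iterates: `T_ω^n = T_{σ^{n-1}ω} ∘ ⋯ ∘ T_ω`. -/
def fiberIter {Ω M : Type*} (σ : Ω → Ω) (T : Ω → M → M) : ℕ → Ω → M → M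
  | 0 => fun _ => id
  | n + 1 => fun ω => fiberIter σ T n (σ ω) ∘ T ω

/-- Iterates of the transfer operators: `L_ω^n = L_{σ^{n-1}ω} ∘ ⋯ ∘ L_ω`. -/
def opIter {Ω M : Type*} (σ : Ω → Ω) (L : Ω → (M → ℝ) → M → ℝ) :
    ℕ → Ω → (M → ℝ) → M → ℝ
  | 0 => fun _ g => g
  | n + 1 => fun ω g => opIter σ L n (σ ω) (L ω g)

/-- Centering: `[g]_ω = g - ∫ g dμ_ω`. -/
def center {M : Type*} [MeasurableSpace M] (μ : Measure M) (g : M → ℝ) : M → ℝ :=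
  fun x => g x - ∫ y, g y ∂μ

/-- The decay estimate of Assumption (A) for a single exponent `s`:
for ℙ-a.e. ω, all `r ≤ i ≤ j` and all Lipschitz `g₁, g₂`,
`‖[L_{σ^i ω}^{j-i}(g₂ ⬝ L_{σ^r ω}^{i-r}(g₁))]_{σ^j ω}‖_{L^s(μ_{σ^j ω})}
  ≤ K(σ^i ω) a_{j-i} (1+‖g₁‖_Lip)(1+‖g₂‖_Lip)`. -/
def DecayBound {Ω M : Type*} [MeasurableSpace Ω] [MetricSpace M] [MeasurableSpace M]
    (ℙ : Measure Ω) (σ : Ω → Ω) (μ : Ω → Measure M)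
    (L : Ω → (M → ℝ) → M → ℝ) (s : ℝ) (K : Ω → ℝ) (a : ℕ → ℝ) : Prop :=
  ∀ᵐ ω ∂ℙ, ∀ r i j : ℕ, r ≤ i → i ≤ j →
    ∀ g₁ g₂ : M → ℝ, IsLip g₁ → IsLip g₂ →
      eLpNorm
        (center (μ (σ^[j] ω))
          (opIter σ L (j - i) (σ^[i] ω)
            (fun x => g₂ x * opIter σ L (i - r) (σ^[r] ω) g₁ x)))
        (ENNReal.ofReal s) (μ (σ^[j] ω))
      ≤ ENNReal.ofReal
          (K (σ^[i] ω) * a (j - i) * (1 + lipNorm g₁) * (1 + lipNorm g₂))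

/-- Birkhoff sums `S_n^ω φ = ∑_{k<n} φ_{σ^k ω} ∘ T_ω^k`. -/
def birkhoff {Ω M : Type*} (σ : Ω → Ω) (T : Ω → M → M) (φ : Ω → M → ℝ)
    (n : ℕ) (ω : Ω) (x : M) : ℝ :=
  ∑ k ∈ Finset.range n, φ (σ^[k] ω) (fiberIter σ T k ω x)

/-- The quenched variance `Σ²_{ω,n} = ∫ (S_n^ω φ)² dμ_ω`. -/
def quenchedVar {Ω M : Type*} [MeasurableSpace M] (σ : Ω → Ω) (T : Ω → M → M)
    (μ : Ω → Measure M) (φ : Ω → M → ℝ) (ω : Ω) (n : ℕ) : ℝ :=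
  ∫ x, (birkhoff σ T φ n ω x) ^ 2 ∂(μ ω)

/-- The martingale–coboundary term `G_{ω,n} = ∑_{j<n} L_{σ^j ω}^{n-j}(φ_{σ^j ω})`. -/
def Gterm {Ω M : Type*} (σ : Ω → Ω) (L : Ω → (M → ℝ) → M → ℝ) (φ : Ω → M → ℝ)
    (ω : Ω) (n : ℕ) (x : M) : ℝ :=
  ∑ j ∈ Finset.range n, opIter σ L (n - j) (σ^[j] ω) (φ (σ^[j] ω)) x

/-- The (reverse) martingale difference `H_{ω,n} = φ_{σ^n ω} + G_{ω,n} - G_{ω,n+1} ∘ T_{σ^n ω}`. -/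
def Hterm {Ω M : Type*} (σ : Ω → Ω) (T : Ω → M → M) (L : Ω → (M → ℝ) → M → ℝ)
    (φ : Ω → M → ℝ) (ω : Ω) (n : ℕ) (x : M) : ℝ :=
  φ (σ^[n] ω) x + Gterm σ L φ ω n x - Gterm σ L φ ω (n + 1) (T (σ^[n] ω) x)

/-- The Liverani–Saussol–Vaienti map with parameter `b`. -/
noncomputable def lsvMap (b : ℝ) (x : ℝ) : ℝ :=
  if x < 1 / 2 then x * (1 + 2 ^ b * x ^ b) else 2 * x - 1

/-- `S_n^δ(ω) = #{0 ≤ i ≤ n-1 : β(δ^i ω) ≤ γ}`. -/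
noncomputable def Scount {Ω : Type*} (β : Ω → ℝ) (γ : ℝ) (δ : Ω → Ω) (n : ℕ) (ω : Ω) : ℕ :=
  ((Finset.range n).filter fun i => β (δ^[i] ω) ≤ γ).card

/-- `N_ε(ω)`: the last time `n ≥ 1` at which one of the ergodic averages
`n⁻¹ S_n^σ(ω)`, `n⁻¹ S_n^{σ⁻¹}(ω)` lies outside `[b₀(1-ε), b₀(1+ε)]` (and `0`
if there is no such time, junk value `0` if the set is unbounded). -/
noncomputable def Neps {Ω : Type*} (β : Ω → ℝ) (γ b₀ ε : ℝ) (σ σinv : Ω → Ω) (ω : Ω) : ℕ :=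
  sSup ({0} ∪ {n : ℕ | 1 ≤ n ∧
    ((Scount β γ σ n ω : ℝ) / n ∉ Set.Icc (b₀ * (1 - ε)) (b₀ * (1 + ε)) ∨
      (Scount β γ σinv n ω : ℝ) / n ∉ Set.Icc (b₀ * (1 - ε)) (b₀ * (1 + ε)))})

/-- The first entry time `τ_ω(x) = inf {n ≥ 1 : T_ω^n(x) ∈ Y}` of the orbit into
`Y = [1/2, 1]` (equal to `⊤` if the orbit never enters `Y`). -/
noncomputable def hitTime {Ω : Type*} (σ : Ω → Ω) (T : Ω → ℝ → ℝ) (ω : Ω) (x : ℝ) : ℕ∞ :=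
  ⨅ (n : ℕ) (_ : 1 ≤ n ∧ fiberIter σ T n ω x ∈ Set.Icc (1 / 2 : ℝ) 1), (n : ℕ∞)

def maxSum {Ω : Type*} (σ : Ω → Ω) (f : Ω → ℝ) : ℕ → Ω → ℝ
  | 0 => fun _ => 0
  | n + 1 => fun ω => max 0 (f ω + maxSum σ f n (σ ω))

theorem maxSum_nonneg {Ω : Type*} (σ : Ω → Ω) (f : Ω → ℝ) (n : ℕ) (ω : Ω) :
    0 ≤ maxSum σ f n ω := by
  cases n <;> simp [maxSum]

theorem maxSum_le_succ {Ω : Type*} (σ : Ω → Ω) (f : Ω → ℝ) (n : ℕ) :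
    ∀ ω, maxSum σ f n ω ≤ maxSum σ f (n + 1) ω := by
  induction n with
  | zero => intro ω; simp [maxSum]
  | succ n ih =>
    intro ω
    have := ih (σ ω)
    simp only [maxSum] at this ⊢
    gcongr

theorem birkhoffSum_le_maxSum {Ω : Type*} (σ : Ω → Ω) (f : Ω → ℝ) (n : ℕ) :
    ∀ ω, birkhoffSum σ f n ω ≤ maxSum σ f n ω := by
  induction n with
  | zero => intro ω; simp [maxSum]
  | succ n ih =>
    intro ω
    rw [birkhoffSum_succ']
    exact le_trans (by simpa using ih (σ ω)) (le_max_right _ _)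

theorem maxSum_measurable {Ω : Type*} [MeasurableSpace Ω] {σ : Ω → Ω} (hσ : Measurable σ)
    {f : Ω → ℝ} (hf : Measurable f) (n : ℕ) : Measurable (maxSum σ f n) := by
  induction n with
  | zero => exact measurable_const
  | succ n ih => exact measurable_const.max (hf.add (ih.comp hσ))

theorem maxSum_le {Ω : Type*} (σ : Ω → Ω) (f : Ω → ℝ) (K : ℝ) (hK : ∀ ω, |f ω| ≤ K) (n : ℕ) :
    ∀ ω, maxSum σ f n ω ≤ n * K := by
  induction n with
  | zero => intro ω; simp [maxSum]
  | succ n ih =>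
    intro ω
    have h1 := ih (σ ω)
    have h2 := abs_le.1 (hK ω)
    have h3 := maxSum_nonneg σ f n (σ ω)
    have h4 : 0 ≤ K := (abs_nonneg _).trans (hK ω)
    simp only [maxSum]
    push_cast
    apply max_le <;> linarith

theorem birkhoff_bddAbove {Ω : Type*} [MeasurableSpace Ω] (P : Measure Ω) [IsProbabilityMeasure P]
    {σ : Ω → Ω} (hσ : Ergodic σ P) {f : Ω → ℝ} (hf : Measurable f) (K : ℝ)
    (hK : ∀ ω, |f ω| ≤ K) (hneg : ∫ ω, f ω ∂P < 0) :
    ∀ᵐ ω ∂P, BddAbove (range fun n => birkhoffSum σ f n ω) := by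
  have hS : ∀ n, Measurable (birkhoffSum σ f n) := by
    intro n
    unfold birkhoffSum
    exact Finset.measurable_sum _ fun i _ => hf.comp (hσ.measurable.iterate i)
  set A : Set Ω := {ω | BddAbove (range fun n => birkhoffSum σ f n ω)} with hA
  have hAm : MeasurableSet A := measurableSet_bddAbove_range hS
  have hinv : σ ⁻¹' A = A := by
    ext ω
    simp only [hA, mem_preimage, mem_ofPred_eq, bddAbove_def, forall_mem_range]
    constructor
    · rintro ⟨M, hM⟩
      refine ⟨max 0 (f ω + M), fun n => ?_⟩
      cases n with
      | zero => simp
      | succ n => rw [birkhoffSum_succ']; exact le_max_of_le_right (by simpa using hM n)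
    · rintro ⟨M, hM⟩
      refine ⟨M - f ω, fun n => ?_⟩
      have := hM (n + 1)
      rw [birkhoffSum_succ'] at this
      linarith
  rcases hσ.toPreErgodic.ae_mem_or_ae_notMem hAm hinv with h | h
  · exact h
  exfalso
  have hMi : ∀ n, Integrable (maxSum σ f n) P := fun n =>
    Integrable.of_bound (maxSum_measurable hσ.measurable hf n).aestronglyMeasurable (n * K)
      (ae_of_all _ fun ω => by
        rw [Real.norm_eq_abs, abs_of_nonneg (maxSum_nonneg _ _ _ _)]
        exact maxSum_le σ f K hK n ω)
  have hMc : ∀ n, Integrable (fun ω => maxSum σ f n (σ ω)) P := fun n =>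
    (hσ.toMeasurePreserving.integrable_comp (hMi n).aestronglyMeasurable).2 (hMi n)
  have hg : ∀ n, 0 ≤ ∫ ω, max (-maxSum σ f n (σ ω)) (f ω) ∂P := by
    intro n
    have e : ∀ ω, max (-maxSum σ f n (σ ω)) (f ω) = maxSum σ f (n + 1) ω - maxSum σ f n (σ ω) := by
      intro ω
      simp only [maxSum]
      rw [max_def, max_def]
      split_ifs <;> linarith
    simp_rw [e]
    rw [integral_sub (hMi _) (hMc _)]
    have : ∫ ω, maxSum σ f n (σ ω) ∂P = ∫ ω, maxSum σ f n ω ∂P := by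
      conv_rhs => rw [← hσ.toMeasurePreserving.map_eq]
      rw [integral_map hσ.measurable.aemeasurable
        (maxSum_measurable hσ.measurable hf n).aestronglyMeasurable]
    rw [this, sub_nonneg]
    exact integral_mono (hMi _) (hMi _) (maxSum_le_succ σ f n)
  have hlim : Tendsto (fun n => ∫ ω, max (-maxSum σ f n (σ ω)) (f ω) ∂P) atTop
      (nhds (∫ ω, f ω ∂P)) := by
    refine tendsto_integral_of_dominated_convergence (fun _ => K) ?_ (integrable_const _) ?_ ?_
    · intro n
      exact (((maxSum_measurable hσ.measurable hf n).comp hσ.measurable).neg.max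
        hf).aestronglyMeasurable
    · intro n
      refine ae_of_all _ fun ω => ?_
      have h2 := abs_le.1 (hK ω)
      have h3 := maxSum_nonneg σ f n (σ ω)
      rw [Real.norm_eq_abs, abs_le]
      constructor
      · exact le_max_of_le_right h2.1
      · apply max_le <;> linarith
    · filter_upwards [h] with ω hω
      have hω' : σ ω ∉ A := by
        intro h'; exact hω (hinv ▸ h')
      simp only [hA, mem_ofPred_eq, bddAbove_def, forall_mem_range, not_exists, not_forall,
        not_le] at hω'
      obtain ⟨N, hN⟩ := hω' (-f ω)
      refine tendsto_const_nhds.congr' ?_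
      filter_upwards [eventually_ge_atTop N] with n hn
      have hm : maxSum σ f N (σ ω) ≤ maxSum σ f n (σ ω) :=
        monotone_nat_of_le_succ (f := fun n => maxSum σ f n (σ ω))
          (fun n => maxSum_le_succ σ f n (σ ω)) hn
      have := birkhoffSum_le_maxSum σ f N (σ ω)
      rw [max_eq_right]
      linarith
  exact absurd (ge_of_tendsto' hlim hg) (not_le.2 hneg)

/-- frequencies of visits eventually close to the measure. -/
theorem freq_eventually {Ω : Type*} [MeasurableSpace Ω] (P : Measure Ω) [IsProbabilityMeasure P]
    {σ : Ω → Ω} (hσ : Ergodic σ P) {B : Set Ω} (hB : MeasurableSet B) (δ : ℝ) (hδ : 0 < δ) :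
    ∀ᵐ ω ∂P, ∀ᶠ n : ℕ in atTop,
      birkhoffSum σ (B.indicator 1) n ω ≤ n * ((P B).toReal + δ) ∧
      n * ((P B).toReal - δ) ≤ birkhoffSum σ (B.indicator (1 : Ω → ℝ)) n ω := by
  set b := (P B).toReal with hb
  have hi : Integrable (B.indicator (1 : Ω → ℝ)) P :=
    (integrable_const (1 : ℝ)).indicator hB
  have hm : Measurable (B.indicator (1 : Ω → ℝ)) := measurable_one.indicator hB
  have hint : ∫ ω, B.indicator (1 : Ω → ℝ) ω ∂P = b := by
    rw [integral_indicator_one hB]; rfl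
  have hbd : ∀ ω, |B.indicator (1 : Ω → ℝ) ω| ≤ 1 := by
    intro ω
    by_cases h : ω ∈ B <;> simp [h]
  have h1 := birkhoff_bddAbove P hσ (f := fun ω => B.indicator (1 : Ω → ℝ) ω - (b + δ / 2))
    (hm.sub_const _) (1 + |b + δ / 2|)
    (fun ω => (abs_sub _ _).trans (by gcongr; exact hbd ω))
    (by rw [integral_sub hi (integrable_const _), hint]; simp; linarith)
  have h2 := birkhoff_bddAbove P hσ (f := fun ω => (b - δ / 2) - B.indicator (1 : Ω → ℝ) ω)
    (hm.const_sub _) (|b - δ / 2| + 1)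
    (fun ω => (abs_sub _ _).trans (by gcongr; exact hbd ω))
    (by rw [integral_sub (integrable_const _) hi, hint]; simp; linarith)
  filter_upwards [h1, h2] with ω ⟨M1, hM1⟩ ⟨M2, hM2⟩
  have hl : Tendsto (fun n : ℕ => (n : ℝ) * (δ / 2)) atTop atTop :=
    tendsto_natCast_atTop_atTop.atTop_mul_const (by positivity)
  filter_upwards [hl.eventually_ge_atTop M1, hl.eventually_ge_atTop M2] with n hn1 hn2
  have a1 := hM1 (mem_range_self n)
  have a2 := hM2 (mem_range_self n)
  simp only [birkhoffSum, Finset.sum_sub_distrib, Finset.sum_const, Finset.card_range,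
    nsmul_eq_mul] at a1 a2 ⊢
  constructor <;> linarith

theorem step_lemma {γ b x : ℝ} (hγ0 : 0 < γ) (hγ1 : γ < 1) (hb : 0 < b)
    (hx : 0 < x) (hx2 : x < 1 / 2) :
    x ≤ lsvMap b x ∧ lsvMap b x ≤ 1 ∧ (lsvMap b x) ^ (-γ) ≤ x ^ (-γ) ∧
      (b ≤ γ → (lsvMap b x) ^ (-γ) + (2 ^ γ - 1) ≤ x ^ (-γ)) := by
  have e : lsvMap b x = x * (1 + (2 * x) ^ b) := by
    unfold lsvMap
    rw [if_pos hx2, Real.mul_rpow (by norm_num) hx.le]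
  have h2x : 0 < 2 * x := by linarith
  have h2x1 : 2 * x ≤ 1 := by linarith
  have hu0 : 0 < (2 * x) ^ b := Real.rpow_pos_of_pos h2x _
  have hu1 : (2 * x) ^ b ≤ 1 := Real.rpow_le_one h2x.le h2x1 hb.le
  rw [e]
  have hle : x ≤ x * (1 + (2 * x) ^ b) := by nlinarith
  refine ⟨hle, by nlinarith, Real.rpow_le_rpow_of_nonpos hx hle (by linarith), fun hbγ => ?_⟩
  set u := (2 * x) ^ γ with hu
  have hu0' : 0 < u := Real.rpow_pos_of_pos h2x _
  have hu1' : u ≤ 1 := Real.rpow_le_one h2x.le h2x1 hγ0.le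
  have huu : u ≤ (2 * x) ^ b := Real.rpow_le_rpow_of_exponent_ge h2x h2x1 hbγ
  have hc : 1 + (2 ^ γ - 1) * u ≤ (1 + u) ^ γ := by
    have := (Real.concaveOn_rpow hγ0.le hγ1.le).2 (show (1 : ℝ) ∈ Set.Ici 0 by simp)
      (show (2 : ℝ) ∈ Set.Ici 0 by simp)
      (show 0 ≤ 1 - u by linarith) hu0'.le (by ring)
    simp only [smul_eq_mul, Real.one_rpow] at this
    rw [show (1 - u) * 1 + u * 2 = 1 + u by ring] at this
    linarith
  have h2γ : 1 < (2 : ℝ) ^ γ := Real.one_lt_rpow (by norm_num) hγ0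
  have h1 : (x * (1 + (2 * x) ^ b)) ^ (-γ) ≤ (x * (1 + u)) ^ (-γ) :=
    Real.rpow_le_rpow_of_nonpos (by positivity) (by gcongr) (by linarith)
  have h2 : (x * (1 + u)) ^ (-γ) = x ^ (-γ) * ((1 + u) ^ γ)⁻¹ := by
    rw [Real.mul_rpow hx.le (by linarith), Real.rpow_neg (by linarith : 0 ≤ 1 + u)]
  have h3 : ((1 + u) ^ γ)⁻¹ ≤ (1 + (2 ^ γ - 1) * u)⁻¹ := by
    apply inv_anti₀ _ hc
    nlinarith
  have h4 : (1 + (2 ^ γ - 1) * u)⁻¹ ≤ 1 - (2 ^ γ - 1) * u / 2 ^ γ := by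
    have hd : 0 < 1 + (2 ^ γ - 1) * u := by nlinarith
    rw [inv_le_iff_one_le_mul₀ hd]
    set t := (2 : ℝ) ^ γ
    have ht : 0 < t := by linarith
    rw [show (1 - (t - 1) * u / t) * (1 + (t - 1) * u)
      = 1 + (t - 1) * u * (t - 1) * (1 - u) / t by field_simp; ring]
    have : 0 ≤ (t - 1) * u * (t - 1) * (1 - u) / t := by
      have a1 : 0 ≤ t - 1 := by linarith
      have a2 : 0 ≤ 1 - u := by linarith
      positivity
    linarith
  have hxγ : 0 < x ^ (-γ) := Real.rpow_pos_of_pos hx _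
  have h5 : x ^ (-γ) * ((2 ^ γ - 1) * u / 2 ^ γ) = 2 ^ γ - 1 := by
    rw [hu, Real.mul_rpow (by norm_num) hx.le, Real.rpow_neg hx.le]
    have : x ^ γ ≠ 0 := (Real.rpow_pos_of_pos hx _).ne'
    have : (2 : ℝ) ^ γ ≠ 0 := by linarith
    field_simp
  have h6 := mul_le_mul_of_nonneg_left (h3.trans h4) hxγ.le
  rw [h2] at h1
  nlinarith

theorem Scount_eq {Ω : Type*} (β : Ω → ℝ) (γ : ℝ) (δ : Ω → Ω) (n : ℕ) (ω : Ω) :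
    (Scount β γ δ n ω : ℝ) = birkhoffSum δ ({ω | β ω ≤ γ}.indicator (1 : Ω → ℝ)) n ω := by
  unfold Scount birkhoffSum
  rw [Finset.card_filter]
  push_cast
  refine Finset.sum_congr rfl fun i _ => ?_
  simp [Set.indicator_apply]

theorem Scount_succ' {Ω : Type*} (β : Ω → ℝ) (γ : ℝ) (δ : Ω → Ω) (n : ℕ) (ω : Ω) :
    (Scount β γ δ (n + 1) ω : ℝ) = (if β ω ≤ γ then 1 else 0) + Scount β γ δ n (δ ω) := by
  rw [Scount_eq, Scount_eq, birkhoffSum_succ']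
  simp [Set.indicator_apply]

theorem Scount_succ {Ω : Type*} (β : Ω → ℝ) (γ : ℝ) (δ : Ω → Ω) (n : ℕ) (ω : Ω) :
    (Scount β γ δ (n + 1) ω : ℝ) = Scount β γ δ n ω + (if β (δ^[n] ω) ≤ γ then 1 else 0) := by
  rw [Scount_eq, Scount_eq, birkhoffSum_succ]
  simp [Set.indicator_apply]

theorem Scount_mono {Ω : Type*} (β : Ω → ℝ) (γ : ℝ) (δ : Ω → Ω) (ω : Ω) {m n : ℕ} (h : m ≤ n) :
    Scount β γ δ m ω ≤ Scount β γ δ n ω := by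
  unfold Scount
  exact Finset.card_le_card (Finset.filter_subset_filter _ (Finset.range_mono h))

theorem Scount_back {Ω : Type*} (β : Ω → ℝ) (γ : ℝ) (σ σinv : Ω → Ω)
    (hinv₂ : Function.RightInverse σinv σ) (n : ℕ) (ω : Ω) (k : ℕ) :
    Scount β γ σ n ω ≤ Scount β γ σ (n + k) (σinv^[k] ω) := by
  induction k with
  | zero => simp
  | succ k ih =>
    refine ih.trans ?_
    have := Scount_succ' β γ σ (n + k) (σinv^[k + 1] ω)
    rw [Function.iterate_succ_apply', hinv₂] at this
    rw [Function.iterate_succ_apply', ← add_assoc]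
    have h0 : (0 : ℝ) ≤ if β (σinv (σinv^[k] ω)) ≤ γ then 1 else 0 := by split_ifs <;> simp
    have : (Scount β γ σ (n + k) (σinv^[k] ω) : ℝ)
      ≤ Scount β γ σ (n + k + 1) (σinv (σinv^[k] ω)) := by linarith
    exact_mod_cast this

theorem Scount_back' {Ω : Type*} (β : Ω → ℝ) (γ : ℝ) (σ σinv : Ω → Ω)
    (hinv₂ : Function.RightInverse σinv σ) (ω : Ω) (k : ℕ) :
    (Scount β γ σinv (k + 1) ω : ℝ) = Scount β γ σ (k + 1) (σinv^[k] ω) := by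
  induction k with
  | zero => rw [Scount_eq, Scount_eq]; simp
  | succ k ih =>
    rw [Scount_succ, ih, Scount_succ' β γ σ (k + 1), Function.iterate_succ_apply', hinv₂, add_comm]

/-- points whose first `n` iterates (from time 0) avoid `[1/2,1]` -/
def avoidSet {Ω : Type*} (σ : Ω → Ω) (T : Ω → ℝ → ℝ) (n : ℕ) (ω : Ω) : Set ℝ :=
  {x | ∀ k < n, fiberIter σ T k ω x ∉ Set.Icc (1 / 2 : ℝ) 1}

theorem le_hitTime_iff {Ω : Type*} (σ : Ω → Ω) (T : Ω → ℝ → ℝ) (n : ℕ) (ω : Ω) (x : ℝ) :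
    ((n : ℕ) : ℕ∞) ≤ hitTime σ T ω x ↔
      ∀ k, 1 ≤ k → k < n → fiberIter σ T k ω x ∉ Set.Icc (1 / 2 : ℝ) 1 := by
  unfold hitTime
  simp only [le_iInf_iff, Nat.cast_le]
  constructor
  · intro h k h1 hk hm
    exact absurd (h k ⟨h1, hm⟩) (not_le.2 hk)
  · rintro h k ⟨h1, hm⟩
    by_contra hk
    exact h k h1 (not_le.1 hk) hm

theorem hitSet_succ {Ω : Type*} (σ : Ω → Ω) (T : Ω → ℝ → ℝ) (n : ℕ) (ω : Ω) :
    {x | ((n + 1 : ℕ) : ℕ∞) ≤ hitTime σ T ω x} = T ω ⁻¹' avoidSet σ T n (σ ω) := by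
  ext x
  simp only [mem_ofPred_eq, mem_preimage, le_hitTime_iff, avoidSet]
  constructor
  · intro h k hk
    exact h (k + 1) (by omega) (by omega)
  · intro h k h1 hk
    obtain ⟨j, rfl⟩ : ∃ j, k = j + 1 := ⟨k - 1, by omega⟩
    exact h j (by omega)

theorem hitSet_subset {Ω : Type*} (σ : Ω → Ω) (T : Ω → ℝ → ℝ) (n : ℕ) (ω : Ω) :
    {x | (n : ℕ∞) ≤ hitTime σ T ω x} ⊆
      (Set.Icc (1 / 2 : ℝ) 1 ∩ {x | (n : ℕ∞) ≤ hitTime σ T ω x}) ∪ avoidSet σ T n ω := by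
  intro x hx
  by_cases hY : x ∈ Set.Icc (1 / 2 : ℝ) 1
  · exact Or.inl ⟨hY, hx⟩
  · right
    intro k hk
    rcases Nat.eq_zero_or_pos k with rfl | h
    · exact hY
    · exact (le_hitTime_iff σ T n ω x).1 hx k h hk

theorem lsvMap_measurable (b : ℝ) : Measurable (lsvMap b) := by
  unfold lsvMap
  refine Measurable.ite measurableSet_Iio ?_ ?_ <;> fun_prop

theorem fiberIter_measurable {Ω : Type*} (σ : Ω → Ω) (T : Ω → ℝ → ℝ)
    (hT : ∀ ω, Measurable (T ω)) (n : ℕ) : ∀ ω, Measurable (fiberIter σ T n ω) := by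
  induction n with
  | zero => intro ω; exact measurable_id
  | succ n ih => intro ω; exact (ih (σ ω)).comp (hT ω)

theorem avoidSet_measurable {Ω : Type*} (σ : Ω → Ω) (T : Ω → ℝ → ℝ)
    (hT : ∀ ω, Measurable (T ω)) (n : ℕ) (ω : Ω) : MeasurableSet (avoidSet σ T n ω) := by
  have : avoidSet σ T n ω = ⋂ k, ⋂ (_ : k < n), (fiberIter σ T k ω ⁻¹' Set.Icc (1 / 2 : ℝ) 1)ᶜ := by
    ext x; simp [avoidSet]
  rw [this]
  exact MeasurableSet.iInter fun k => MeasurableSet.iInter fun _ =>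
    ((fiberIter_measurable σ T hT k ω) measurableSet_Icc).compl

theorem avoid_growth {Ω : Type*} (σ : Ω → Ω) (β : Ω → ℝ) (hβ : ∀ ω, 0 < β ω)
    {γ : ℝ} (hγ0 : 0 < γ) (hγ1 : γ < 1) (T : Ω → ℝ → ℝ) (hT : ∀ ω, T ω = lsvMap (β ω)) (n : ℕ) :
    ∀ ω x, 0 < x → x ≤ 1 → x ∈ avoidSet σ T n ω →
      1 + (2 ^ γ - 1) * (Scount β γ σ n ω : ℝ) ≤ x ^ (-γ) := by
  induction n with
  | zero =>
    intro ω x h0 h1 _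
    have := Real.one_le_rpow_of_pos_of_le_one_of_nonpos h0 h1 (by linarith : -γ ≤ 0)
    simpa [Scount] using this
  | succ n ih =>
    intro ω x h0 h1 hx
    have hx2 : x < 1 / 2 := by
      have := hx 0 (by omega)
      by_contra h
      exact this ⟨not_lt.1 h, h1⟩
    have hx' : T ω x ∈ avoidSet σ T n (σ ω) := fun k hk => hx (k + 1) (by omega)
    obtain ⟨s1, s2, s3, s4⟩ := step_lemma hγ0 hγ1 (hβ ω) h0 hx2
    rw [← hT] at s1 s2 s3 s4
    have := ih (σ ω) (T ω x) (h0.trans_le s1) s2 hx'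
    rw [Scount_succ']
    split_ifs with hb
    · have := s4 hb; linarith
    · linarith

theorem avoid_le {Ω : Type*} (σ : Ω → Ω) (β : Ω → ℝ) (hβ : ∀ ω, 0 < β ω)
    {γ : ℝ} (hγ0 : 0 < γ) (hγ1 : γ < 1) (T : Ω → ℝ → ℝ) (hT : ∀ ω, T ω = lsvMap (β ω)) (n : ℕ)
    (ω : Ω) (x : ℝ) (h0 : 0 < x) (h1 : x ≤ 1) (hx : x ∈ avoidSet σ T n ω) (s : ℝ) (hs : 0 < s)
    (hsS : s ≤ 1 + Scount β γ σ n ω) :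
    x ≤ (2 ^ γ - 1) ^ (-(1 / γ)) * s ^ (-(1 / γ)) := by
  have h := avoid_growth σ β hβ hγ0 hγ1 T hT n ω x h0 h1 hx
  have h2γ : 1 < (2 : ℝ) ^ γ := Real.one_lt_rpow (by norm_num) hγ0
  have h2γ' : (2 : ℝ) ^ γ ≤ 2 := by
    simpa using Real.rpow_le_rpow_of_exponent_le (by norm_num : (1 : ℝ) ≤ 2) hγ1.le
  have hc : 0 < (2 : ℝ) ^ γ - 1 := by linarith
  have h3 : (2 ^ γ - 1) * s ≤ x ^ (-γ) := by nlinarith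
  rw [← Real.mul_rpow hc.le hs.le]
  have h4 := Real.rpow_le_rpow_of_nonpos (by positivity : 0 < (2 ^ γ - 1) * s) h3
    (by have := one_div_pos.2 hγ0; linarith : -(1 / γ) ≤ 0)
  rw [← Real.rpow_mul h0.le] at h4
  rw [show -γ * -(1 / γ) = 1 by field_simp, Real.rpow_one] at h4
  exact h4

theorem Yhit_volume {Ω : Type*} (σ : Ω → Ω) (β : Ω → ℝ) (hβ : ∀ ω, 0 < β ω)
    {γ : ℝ} (hγ0 : 0 < γ) (hγ1 : γ < 1) (T : Ω → ℝ → ℝ) (hT : ∀ ω, T ω = lsvMap (β ω)) (n : ℕ)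
    (hn : 1 ≤ n) (ω : Ω) (s : ℝ) (hs : 0 < s) (hsS : s ≤ Scount β γ σ n ω) :
    2 * volume (Set.Icc (1 / 2 : ℝ) 1 ∩ {x | (n : ℕ∞) ≤ hitTime σ T ω x}) ≤
      ENNReal.ofReal ((2 ^ γ - 1) ^ (-(1 / γ)) * s ^ (-(1 / γ))) := by
  obtain ⟨m, rfl⟩ : ∃ m, n = m + 1 := ⟨n - 1, by omega⟩
  set R := (2 ^ γ - 1) ^ (-(1 / γ)) * s ^ (-(1 / γ)) with hR
  have h2γ : 1 < (2 : ℝ) ^ γ := Real.one_lt_rpow (by norm_num) hγ0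
  have hc : 0 < (2 : ℝ) ^ γ - 1 := by linarith
  have hR0 : 0 < R := by positivity
  have hsub : Set.Icc (1 / 2 : ℝ) 1 ∩ {x | ((m + 1 : ℕ) : ℕ∞) ≤ hitTime σ T ω x} ⊆
      Set.Icc (1 / 2) (1 / 2 + R / 2) := by
    rintro x ⟨⟨hx1, hx2⟩, hx⟩
    rw [hitSet_succ] at hx
    refine ⟨hx1, ?_⟩
    rcases hx1.eq_or_lt with h | h
    · linarith
    have hTx : T ω x = 2 * x - 1 := by
      rw [hT, lsvMap, if_neg (not_lt.2 hx1)]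
    have hx' : 2 * x - 1 ∈ avoidSet σ T m (σ ω) := hTx ▸ hx
    have := avoid_le σ β hβ hγ0 hγ1 T hT m (σ ω) (2 * x - 1) (by linarith) (by linarith) hx' s hs
      (by
        rw [Scount_succ'] at hsS
        refine hsS.trans ?_
        gcongr
        split_ifs <;> simp)
    linarith
  calc _ ≤ 2 * volume (Set.Icc (1 / 2 : ℝ) (1 / 2 + R / 2)) := by gcongr
    _ = ENNReal.ofReal R := by
      rw [Real.volume_Icc, show (2 : ℝ≥0∞) = ENNReal.ofReal 2 by simp,
        ← ENNReal.ofReal_mul (by norm_num)]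
      congr 1; ring

theorem sum_lemma {p : ℝ} (hp : 1 < p) (n : ℕ) (hn : 1 ≤ n) (K : ℕ) :
    ∑ k ∈ Finset.range K, ((n : ℝ) + k) ^ (-p) ≤ (p + 1) / (p - 1) * (n : ℝ) ^ (1 - p) := by
  have key : ∀ r : ℝ, 1 ≤ r →
      r ^ (-p) ≤ (p + 1) / (p - 1) * (r ^ (1 - p) - (r + 1) ^ (1 - p)) := by
    intro r hr
    have hr0 : 0 < r := by linarith
    have hB := one_add_mul_self_le_rpow_one_add (s := 1 / r)
      (by have := one_div_pos.2 hr0; linarith) hp.le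
    have e1 : (1 + 1 / r) ^ p = (r + 1) ^ p * r ^ (-p) := by
      rw [show 1 + 1 / r = (r + 1) / r by field_simp, Real.div_rpow (by linarith) hr0.le,
        Real.rpow_neg hr0.le]; rfl
    rw [e1] at hB
    have e2 : r ^ (1 - p) = r * r ^ (-p) := by
      rw [sub_eq_add_neg, Real.rpow_add hr0, Real.rpow_one]
    have e3 : (r + 1) ^ (1 - p) = (r + 1) * ((r + 1) ^ p)⁻¹ := by
      rw [sub_eq_add_neg, Real.rpow_add (by linarith), Real.rpow_one,
        Real.rpow_neg (by linarith : 0 ≤ r + 1)]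
    rw [e2, e3]
    set A := (r + 1) ^ p with hA
    set B := r ^ (-p) with hBd
    have hA0 : 0 < A := Real.rpow_pos_of_pos (by linarith) _
    have hB0 : 0 < B := Real.rpow_pos_of_pos hr0 _
    have hAinv : A⁻¹ ≤ B * (r / (r + p)) := by
      rw [inv_le_iff_one_le_mul₀ hA0]
      have : 1 + p * (1 / r) = (r + p) / r := by field_simp
      rw [this] at hB
      have h7 : r / (r + p) * ((r + p) / r) = 1 := by
        have : r + p ≠ 0 := by linarith
        field_simp
      calc (1 : ℝ) = r / (r + p) * ((r + p) / r) := h7.symm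
        _ ≤ r / (r + p) * (A * B) := by
          gcongr
        _ = _ := by ring
    have h8 : (r + 1) * A⁻¹ ≤ (r + 1) * (B * (r / (r + p))) := by gcongr
    have hp1 : 0 < p - 1 := by linarith
    have h9 : B ≤ (p + 1) / (p - 1) * (r * B - (r + 1) * (B * (r / (r + p)))) := by
      have : (p + 1) / (p - 1) * (r * B - (r + 1) * (B * (r / (r + p))))
        = B * ((p + 1) * r / (r + p)) := by
        have : r + p ≠ 0 := by linarith
        field_simp
        ring
      rw [this]
      have : 1 ≤ (p + 1) * r / (r + p) := by
        rw [le_div_iff₀ (by linarith)]; nlinarith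
      nlinarith
    refine h9.trans ?_
    gcongr
  have hC : 0 < (p + 1) / (p - 1) := div_pos (by linarith) (by linarith)
  have hn' : (1 : ℝ) ≤ n := by exact_mod_cast hn
  suffices h : ∑ k ∈ Finset.range K, ((n : ℝ) + k) ^ (-p)
      ≤ (p + 1) / (p - 1) * ((n : ℝ) ^ (1 - p) - ((n : ℝ) + K) ^ (1 - p)) by
    refine h.trans ?_
    gcongr
    have : 0 ≤ ((n : ℝ) + K) ^ (1 - p) := by positivity
    linarith
  induction K with
  | zero => simp
  | succ K ih =>
    rw [Finset.sum_range_succ]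
    have := key (n + K) (by have : (0 : ℝ) ≤ K := by positivity
                            linarith)
    push_cast
    rw [← add_assoc]
    linarith

theorem density_Y_le (h : ℝ → ℝ) (μ : Measure ℝ)
    (hμdef : μ = (volume.restrict (Set.Icc (0 : ℝ) 1)).withDensity fun x => ENNReal.ofReal (h x))
    (hμprob : IsProbabilityMeasure μ) (hanti : AntitoneOn h (Set.Ioc 0 1))
    (E : Set ℝ) (hE : MeasurableSet E) :
    μ (Set.Icc (1 / 2 : ℝ) 1 ∩ E) ≤ 2 * volume (Set.Icc (1 / 2 : ℝ) 1 ∩ E) := by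
  have hhalf : ENNReal.ofReal (h (1 / 2)) ≤ 2 := by
    have h1 : μ (Set.Ioc (0 : ℝ) (1 / 2)) ≤ 1 := prob_le_one
    rw [hμdef, withDensity_apply _ measurableSet_Ioc, Measure.restrict_restrict measurableSet_Ioc,
      inter_eq_left.2 (show Set.Ioc (0 : ℝ) (1 / 2) ⊆ Set.Icc 0 1 from
        fun x hx => ⟨hx.1.le, hx.2.trans (by norm_num)⟩)] at h1
    have h2 : ∫⁻ _ in Set.Ioc (0 : ℝ) (1 / 2), ENNReal.ofReal (h (1 / 2)) ≤
        ∫⁻ x in Set.Ioc (0 : ℝ) (1 / 2), ENNReal.ofReal (h x) := by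
      refine setLIntegral_mono' measurableSet_Ioc fun x hx => ENNReal.ofReal_le_ofReal ?_
      exact hanti ⟨hx.1, hx.2.trans (by norm_num)⟩ ⟨by norm_num, by norm_num⟩ hx.2
    rw [setLIntegral_const, Real.volume_Ioc] at h2
    have h3 := h2.trans h1
    rw [sub_zero] at h3
    calc ENNReal.ofReal (h (1 / 2))
        = ENNReal.ofReal (h (1 / 2)) * ENNReal.ofReal (1 / 2) * 2 := by
          rw [mul_assoc, show (2 : ℝ≥0∞) = ENNReal.ofReal 2 by simp,
            ← ENNReal.ofReal_mul (by norm_num)]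
          norm_num
      _ ≤ 1 * 2 := by gcongr
      _ = 2 := one_mul _
  have hm : MeasurableSet (Set.Icc (1 / 2 : ℝ) 1 ∩ E) := measurableSet_Icc.inter hE
  rw [hμdef, withDensity_apply _ hm, Measure.restrict_restrict hm,
    inter_eq_left.2 (show Set.Icc (1 / 2 : ℝ) 1 ∩ E ⊆ Set.Icc 0 1 from
      fun x hx => ⟨le_trans (by norm_num) hx.1.1, hx.1.2⟩)]
  calc _ ≤ ∫⁻ _ in Set.Icc (1 / 2 : ℝ) 1 ∩ E, 2 := by
        refine setLIntegral_mono' hm fun x hx => le_trans (ENNReal.ofReal_le_ofReal ?_) hhalf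
        exact hanti ⟨by norm_num, by norm_num⟩ ⟨lt_of_lt_of_le (by norm_num) hx.1.1, hx.1.2⟩ hx.1.1
    _ = _ := by rw [setLIntegral_const]

theorem density_Ioc_le (h : ℝ → ℝ) (μ : Measure ℝ)
    (hμdef : μ = (volume.restrict (Set.Icc (0 : ℝ) 1)).withDensity fun x => ENNReal.ofReal (h x))
    (hμprob : IsProbabilityMeasure μ) (hcont : ContinuousOn h (Set.Ioc 0 1))
    (hnn : ∀ x ∈ Set.Icc (0 : ℝ) 1, 0 ≤ h x) (acone θ : ℝ)
    (hcone : ∀ x ∈ Set.Ioc (0 : ℝ) 1,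
        (∫ u in Set.Ioc (0 : ℝ) x, h u) ≤ acone * x ^ θ * ∫ u in Set.Ioc (0 : ℝ) 1, h u)
    (x : ℝ) (hx : x ∈ Set.Ioc (0 : ℝ) 1) :
    μ (Set.Ioc 0 x) ≤ ENNReal.ofReal (acone * x ^ θ) := by
  have hM : ∀ y ∈ Set.Ioc (0 : ℝ) 1,
      μ (Set.Ioc 0 y) = ∫⁻ u in Set.Ioc 0 y, ENNReal.ofReal (h u) := by
    intro y hy
    rw [hμdef, withDensity_apply _ measurableSet_Ioc, Measure.restrict_restrict measurableSet_Ioc,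
      inter_eq_left.2 (show Set.Ioc 0 y ⊆ Set.Icc 0 1 from
        fun x hx => ⟨hx.1.le, hx.2.trans hy.2⟩)]
  have hI : ∀ y ∈ Set.Ioc (0 : ℝ) 1, ∫ u in Set.Ioc (0 : ℝ) y, h u = (μ (Set.Ioc 0 y)).toReal := by
    intro y hy
    rw [hM y hy]
    refine integral_eq_lintegral_of_nonneg_ae ?_ ?_
    · filter_upwards [ae_restrict_mem measurableSet_Ioc] with u hu
      exact hnn u ⟨hu.1.le, hu.2.trans hy.2⟩
    · exact (hcont.mono (Set.Ioc_subset_Ioc_right hy.2)).aestronglyMeasurable measurableSet_Ioc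
  have h1 : μ (Set.Ioc 0 1) = 1 := by
    have h2 : μ Set.univ = 1 := measure_univ
    rw [hM 1 (by simp), restrict_Ioc_eq_restrict_Icc]
    rwa [hμdef, withDensity_apply _ MeasurableSet.univ, Measure.restrict_univ] at h2
  have := hcone x hx
  rw [hI x hx, hI 1 (by simp), h1] at this
  simp only [ENNReal.toReal_one, mul_one] at this
  exact (ENNReal.le_ofReal_iff_toReal_le (measure_ne_top _ _)
    (ENNReal.toReal_nonneg.trans this)).2 this

theorem avoid_measure {Ω : Type*} (σ : Ω → Ω) (β : Ω → ℝ) (hβ : ∀ ω, 0 < β ω)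
    {γ : ℝ} (hγ0 : 0 < γ) (hγ1 : γ < 1) (T : Ω → ℝ → ℝ) (hT : ∀ ω, T ω = lsvMap (β ω)) (n : ℕ)
    (ω : Ω) (s : ℝ) (hs : 0 < s) (hsS : s ≤ Scount β γ σ n ω)
    (h : ℝ → ℝ) (μ : Measure ℝ)
    (hμdef : μ = (volume.restrict (Set.Icc (0 : ℝ) 1)).withDensity fun x => ENNReal.ofReal (h x)) :
    μ (avoidSet σ T n ω) ≤
      μ (Set.Ioc 0 ((2 ^ γ - 1) ^ (-(1 / γ)) * s ^ (-(1 / γ)))) := by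
  have hac : μ ≪ volume.restrict (Set.Icc (0 : ℝ) 1) := by
    rw [hμdef]; exact withDensity_absolutelyContinuous _ _
  refine measure_mono_ae (hac.ae_le ?_)
  have h0 : ∀ᵐ x ∂(volume.restrict (Set.Icc (0 : ℝ) 1)), x ≠ 0 :=
    ae_restrict_of_ae (Measure.ae_ne volume 0)
  filter_upwards [ae_restrict_mem measurableSet_Icc, h0] with x hx hx0 hxa
  have hx' : 0 < x := lt_of_le_of_ne hx.1 (Ne.symm hx0)
  exact ⟨hx', avoid_le σ β hβ hγ0 hγ1 T hT n ω x hx' hx.2 hxa s hs (by linarith)⟩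

/-- deterministic core of part (i) -/
theorem tail_core {Ω : Type*} (σ σinv : Ω → Ω) (hinv₂ : Function.RightInverse σinv σ)
    (β : Ω → ℝ) (hβ : ∀ ω, 0 < β ω)
    {γ : ℝ} (hγ0 : 0 < γ) (hγ1 : γ < 1) (T : Ω → ℝ → ℝ) (hT : ∀ ω, T ω = lsvMap (β ω))
    (h : Ω → ℝ → ℝ) (μ : Ω → Measure ℝ)
    (hμdef : ∀ ω, μ ω =
      (volume.restrict (Set.Icc (0 : ℝ) 1)).withDensity fun x => ENNReal.ofReal (h ω x))
    (hμprob : ∀ ω, IsProbabilityMeasure (μ ω)) (acone θ : ℝ) (hθ : 0 < θ) (ω : Ω)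
    (hequi : ∀ k, Measure.map (T (σinv^[k] ω)) (μ (σinv^[k] ω)) = μ (σ (σinv^[k] ω)))
    (hcont : ∀ k, ContinuousOn (h (σinv^[k] ω)) (Set.Ioc 0 1))
    (hanti : ∀ k, AntitoneOn (h (σinv^[k] ω)) (Set.Ioc 0 1))
    (hnn : ∀ k, ∀ x ∈ Set.Icc (0 : ℝ) 1, 0 ≤ h (σinv^[k] ω) x)
    (hcone : ∀ k, ∀ x ∈ Set.Ioc (0 : ℝ) 1,
        (∫ u in Set.Ioc (0 : ℝ) x, h (σinv^[k] ω) u) ≤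
          acone * x ^ θ * ∫ u in Set.Ioc (0 : ℝ) 1, h (σinv^[k] ω) u)
    (n : ℕ) (hn : 1 ≤ n) (d : ℝ) (hd : 0 < d)
    (hS : ∀ k : ℕ, d * ((n : ℝ) + k) ≤ Scount β γ σ (n + k) (σinv^[k] ω)) :
    μ ω {x | (n : ℕ∞) ≤ hitTime σ T ω x} ≤
      ENNReal.ofReal ((2 ^ γ - 1) ^ (-(1 / γ)) * d ^ (-(1 / γ)) *
        ((1 / γ + 1) / (1 / γ - 1)) * (n : ℝ) ^ (1 - 1 / γ)) := by
  set p := 1 / γ with hp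
  have hp1 : 1 < p := (one_lt_div hγ0).2 hγ1
  have h2γ : 1 < (2 : ℝ) ^ γ := Real.one_lt_rpow (by norm_num) hγ0
  have hc : 0 < (2 : ℝ) ^ γ - 1 := by linarith
  have hn' : (1 : ℝ) ≤ n := by exact_mod_cast hn
  have hTm : ∀ ω, Measurable (T ω) := fun ω => hT ω ▸ lsvMap_measurable _
  set D := ((2 : ℝ) ^ γ - 1) ^ (-p) with hD
  have hD0 : 0 < D := Real.rpow_pos_of_pos hc _
  have hspos : ∀ k : ℕ, 0 < d * ((n : ℝ) + k) := fun k => by positivity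
  have hBm : ∀ m ω', 1 ≤ m → MeasurableSet {x | ((m : ℕ) : ℕ∞) ≤ hitTime σ T ω' x} := by
    intro m ω' hm
    obtain ⟨j, rfl⟩ : ∃ j, m = j + 1 := ⟨m - 1, by omega⟩
    rw [hitSet_succ]
    exact hTm ω' (avoidSet_measurable σ T hTm j _)
  -- one step
  have hstep : ∀ k : ℕ, μ (σinv^[k] ω) {x | ((n + k : ℕ) : ℕ∞) ≤ hitTime σ T (σinv^[k] ω) x} ≤
      ENNReal.ofReal (D * d ^ (-p) * ((n : ℝ) + k) ^ (-p)) +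
        μ (σinv^[k] ω) (avoidSet σ T (n + k) (σinv^[k] ω)) := by
    intro k
    refine (measure_mono (hitSet_subset σ T (n + k) (σinv^[k] ω))).trans
      ((measure_union_le _ _).trans ?_)
    gcongr
    refine (density_Y_le _ _ (hμdef _) (hμprob _) (hanti k) _ (hBm _ _ (by omega))).trans ?_
    refine (Yhit_volume σ β hβ hγ0 hγ1 T hT (n + k) (by omega) _ _ (hspos k) (hS k)).trans ?_
    rw [Real.mul_rpow hd.le (by positivity), mul_assoc]
  have hback : ∀ k : ℕ, μ (σinv^[k] ω) (avoidSet σ T (n + k) (σinv^[k] ω)) =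
      μ (σinv^[k + 1] ω) {x | ((n + (k + 1) : ℕ) : ℕ∞) ≤ hitTime σ T (σinv^[k + 1] ω) x} := by
    intro k
    have e : σ (σinv^[k + 1] ω) = σinv^[k] ω := by
      rw [Function.iterate_succ_apply', hinv₂]
    rw [← add_assoc, hitSet_succ, e]
    have := hequi (k + 1)
    rw [e] at this
    rw [← this, Measure.map_apply (hTm _) (avoidSet_measurable σ T hTm _ _)]
  have hsum : ∀ K : ℕ, μ ω {x | (n : ℕ∞) ≤ hitTime σ T ω x} ≤
      ENNReal.ofReal (D * d ^ (-p) * ∑ k ∈ Finset.range (K + 1), ((n : ℝ) + k) ^ (-p)) +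
        μ (σinv^[K] ω) (avoidSet σ T (n + K) (σinv^[K] ω)) := by
    intro K
    induction K with
    | zero => simpa using hstep 0
    | succ K ih =>
      refine ih.trans ?_
      rw [hback, Finset.sum_range_succ _ (K + 1), mul_add,
        ENNReal.ofReal_add (by positivity) (by positivity), add_assoc]
      gcongr
      exact hstep (K + 1)
  have hrem : Tendsto (fun K : ℕ => D * (d * ((n : ℝ) + K)) ^ (-p)) atTop (nhds 0) := by
    have t1 : Tendsto (fun K : ℕ => d * ((n : ℝ) + K)) atTop atTop :=
      (tendsto_atTop_add_const_left _ _ tendsto_natCast_atTop_atTop).const_mul_atTop hd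
    simpa using ((tendsto_rpow_neg_atTop (by linarith : 0 < p)).comp t1).const_mul D
  have hrem2 : Tendsto (fun K : ℕ => ENNReal.ofReal
      (acone * (D * (d * ((n : ℝ) + K)) ^ (-p)) ^ θ)) atTop (nhds 0) := by
    have := ENNReal.tendsto_ofReal ((hrem.rpow_const (Or.inr hθ.le)).const_mul acone)
    simpa [Real.zero_rpow hθ.ne'] using this
  have hfin : ∀ᶠ K : ℕ in atTop, μ ω {x | (n : ℕ∞) ≤ hitTime σ T ω x} ≤
      ENNReal.ofReal (D * d ^ (-p) * ((p + 1) / (p - 1)) * (n : ℝ) ^ (1 - p)) +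
        ENNReal.ofReal (acone * (D * (d * ((n : ℝ) + K)) ^ (-p)) ^ θ) := by
    filter_upwards [hrem.eventually (gt_mem_nhds one_pos)] with K hK
    refine (hsum K).trans ?_
    gcongr ?_ + ?_
    · apply ENNReal.ofReal_le_ofReal
      rw [mul_assoc (D * d ^ (-p))]
      gcongr
      exact sum_lemma hp1 n hn (K + 1)
    · refine (avoid_measure σ β hβ hγ0 hγ1 T hT (n + K) _ _ (hspos K) (hS K) _ _
        (hμdef _)).trans ?_
      exact density_Ioc_le _ _ (hμdef _) (hμprob _) (hcont K) (hnn K) acone θ (hcone K) _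
        ⟨mul_pos hD0 (Real.rpow_pos_of_pos (hspos K) _), hK.le⟩
  have := ge_of_tendsto (tendsto_const_nhds.add hrem2) hfin
  simpa using this

theorem Neps_spec {Ω : Type*} (β : Ω → ℝ) (γ b ε : ℝ) (σ σinv : Ω → Ω) (ω : Ω)
    (h1 : ∀ᶠ n : ℕ in atTop, (Scount β γ σ n ω : ℝ) ≤ n * (b + b * ε) ∧
      n * (b - b * ε) ≤ (Scount β γ σ n ω : ℝ))
    (h2 : ∀ᶠ n : ℕ in atTop, (Scount β γ σinv n ω : ℝ) ≤ n * (b + b * ε) ∧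
      n * (b - b * ε) ≤ (Scount β γ σinv n ω : ℝ))
    (n : ℕ) (hn : Neps β γ b ε σ σinv ω < n) :
    n * (b * (1 - ε)) ≤ Scount β γ σ n ω ∧ n * (b * (1 - ε)) ≤ Scount β γ σinv n ω := by
  have hn0 : 1 ≤ n := by omega
  unfold Neps at hn
  have key := notMem_of_csSup_lt hn (by
    obtain ⟨N, hN⟩ := eventually_atTop.1 (h1.and h2)
    refine ⟨N, ?_⟩
    rintro m (hm | ⟨hm1, hm⟩)
    · simp at hm; omega
    · by_contra hlt
      obtain ⟨⟨a1, a2⟩, a3, a4⟩ := hN m (by omega)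
      have hm0 : (0 : ℝ) < m := by exact_mod_cast hm1
      rcases hm with hm | hm
      · refine hm ⟨?_, ?_⟩
        · rw [le_div_iff₀ hm0]; linarith
        · rw [div_le_iff₀ hm0]; linarith
      · refine hm ⟨?_, ?_⟩
        · rw [le_div_iff₀ hm0]; linarith
        · rw [div_le_iff₀ hm0]; linarith)
  have hnp : (0 : ℝ) < n := by exact_mod_cast hn0
  have key2 : ¬ ((Scount β γ σ n ω : ℝ) / n ∉ Set.Icc (b * (1 - ε)) (b * (1 + ε)) ∨
      (Scount β γ σinv n ω : ℝ) / n ∉ Set.Icc (b * (1 - ε)) (b * (1 + ε))) :=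
    fun hh => key (Or.inr ⟨hn0, hh⟩)
  push Not at key2
  obtain ⟨⟨k1, _⟩, ⟨k2, _⟩⟩ := key2
  rw [le_div_iff₀ hnp] at k1 k2
  constructor <;> linarith

/-- tail bounds of the return times for random LSV maps. -/
theorem lsv_return_time_tails
    {Ω : Type*} [MeasurableSpace Ω]
    (ℙ : Measure Ω) [IsProbabilityMeasure ℙ]
    (σ σinv : Ω → Ω) (hσ : MeasurePreserving σ ℙ ℙ) (hσerg : Ergodic σ ℙ)
    (hinv₁ : Function.LeftInverse σinv σ) (hinv₂ : Function.RightInverse σinv σ)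
    (hσinv : Measurable σinv)
    -- the random parameter β(ω) ∈ (0,1), with esssup β < 1
    (β : Ω → ℝ) (hβmeas : Measurable β) (hβ01 : ∀ ω, 0 < β ω ∧ β ω < 1)
    (βsup : ℝ) (hβsup : βsup < 1) (hβbound : ∀ᵐ ω ∂ℙ, β ω ≤ βsup)
    -- the parameter γ, with b₀ = ℙ(β(ω) ≤ γ) > 0
    (γ : ℝ) (hγ0 : 0 < γ) (hγ1 : γ < 1)
    (hb₀ : 0 < (ℙ {ω' | β ω' ≤ γ}).toReal)
    -- the random LSV maps
    (T : Ω → ℝ → ℝ) (hTdef : ∀ ω, T ω = lsvMap (β ω))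
    -- the unique random a.c.i.m. family, with densities in the cones 𝒞_* ∩ 𝒞₂
    (h : Ω → ℝ → ℝ) (μ : Ω → Measure ℝ)
    (hμdef : ∀ ω, μ ω =
      (volume.restrict (Set.Icc (0 : ℝ) 1)).withDensity fun x => ENNReal.ofReal (h ω x))
    (hμprob : ∀ ω, IsProbabilityMeasure (μ ω))
    (hequi : ∀ᵐ ω ∂ℙ, Measure.map (T ω) (μ ω) = μ (σ ω))
    (acone : ℝ) (hacone : 1 < acone)
    (hcone : ∀ᵐ ω ∂ℙ,
      ContinuousOn (h ω) (Set.Ioc 0 1) ∧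
      AntitoneOn (h ω) (Set.Ioc 0 1) ∧
      MonotoneOn (fun x => x ^ (βsup + 1) * h ω x) (Set.Ioc 0 1) ∧
      ∀ x ∈ Set.Ioc (0 : ℝ) 1,
        (∫ u in Set.Ioc (0 : ℝ) x, h ω u)
          ≤ acone * x ^ (1 - βsup) * ∫ u in Set.Ioc (0 : ℝ) 1, h ω u)
    (c : ℝ) (hc : 0 < c) (hlow : ∀ᵐ ω ∂ℙ, ∀ x ∈ Set.Icc (0 : ℝ) 1, c ≤ h ω x)
    -- the transfer operators 𝓛_ω w.r.t. Lebesgue measure and L_ω = 𝓛_ω(· h_ω)/h_{σω}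
    (𝓛 : Ω → (ℝ → ℝ) → ℝ → ℝ)
    (h𝓛 : ∀ᵐ ω ∂ℙ, ∀ f g : ℝ → ℝ, Measurable f →
      Integrable f (volume.restrict (Set.Icc (0 : ℝ) 1)) → Measurable g →
      (∃ Cg, ∀ x, |g x| ≤ Cg) →
      ∫ x in Set.Icc (0 : ℝ) 1, 𝓛 ω f x * g x = ∫ x in Set.Icc (0 : ℝ) 1, f x * g (T ω x))
    (L : Ω → (ℝ → ℝ) → ℝ → ℝ)
    (hL : ∀ ω g x, L ω g x = 𝓛 ω (fun y => g y * h ω y) x / h (σ ω) x)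
 :
    ∃ C : ℝ, 0 < C ∧
      ∀ ε : ℝ, 0 < ε → ε < 1 / 2 →
        ∀ᵐ ω ∂ℙ, ∀ n : ℕ, 1 ≤ n →
          (μ ω {x | (n : ℕ∞) ≤ hitTime σ T ω x}).toReal
              ≤ C * ((Neps β γ ((ℙ {ω' | β ω' ≤ γ}).toReal) ε σ σinv ω : ℝ) + 1)
                    ^ (max 1 (1 / γ - 1))
                  * (n : ℝ) ^ (1 - 1 / γ) ∧
          ((2 : ℝ≥0∞) • volume.restrict (Set.Icc (1 / 2 : ℝ) 1))
              {x | (n : ℕ∞) ≤ hitTime σ T ω x}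
            ≤ ENNReal.ofReal C * (Scount β γ σ n ω : ℝ≥0∞) ^ (-(1 / γ) : ℝ) := by
  set b := (ℙ {ω' | β ω' ≤ γ}).toReal with hb
  have hβ : ∀ ω, 0 < β ω := fun ω => (hβ01 ω).1
  have hp1 : 1 < 1 / γ := (one_lt_div hγ0).2 hγ1
  have h2γ : 1 < (2 : ℝ) ^ γ := Real.one_lt_rpow (by norm_num) hγ0
  have hc2 : 0 < (2 : ℝ) ^ γ - 1 := by linarith
  have hBmeas : MeasurableSet {ω' | β ω' ≤ γ} := hβmeas measurableSet_Iic
  let e : Ω ≃ᵐ Ω := ⟨⟨σ, σinv, hinv₁, hinv₂⟩, hσ.measurable, hσinv⟩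
  have hinvErg : Ergodic σinv ℙ := Ergodic.symm (e := e) hσerg
  have hq : ∀ k, Measure.QuasiMeasurePreserving (σinv^[k]) ℙ ℙ := fun k =>
    (hinvErg.toMeasurePreserving.iterate k).quasiMeasurePreserving
  have hequi' : ∀ᵐ ω ∂ℙ, ∀ k, Measure.map (T (σinv^[k] ω)) (μ (σinv^[k] ω))
      = μ (σ (σinv^[k] ω)) := ae_all_iff.2 fun k => (hq k).ae hequi
  have hcone' := ae_all_iff.2 fun k => (hq k).ae hcone
  have hlow' := ae_all_iff.2 fun k => (hq k).ae hlow
  set D := ((2 : ℝ) ^ γ - 1) ^ (-(1 / γ)) with hD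
  have hD0 : 0 < D := Real.rpow_pos_of_pos hc2 _
  set C1 := D * (b / 4) ^ (-(1 / γ)) * ((1 / γ + 1) / (1 / γ - 1)) with hC1
  have hC10 : 0 < C1 := by
    have h1 : 0 < 1 / γ - 1 := by linarith
    have h2 : 0 < (b / 4) ^ (-(1 / γ)) := Real.rpow_pos_of_pos (by linarith) _
    positivity
  refine ⟨1 + D + C1, by positivity, fun ε hε0 hε1 => ?_⟩
  have hf1 := freq_eventually ℙ hσerg hBmeas (b * ε) (by positivity)
  have hf2 := freq_eventually ℙ hinvErg hBmeas (b * ε) (by positivity)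
  filter_upwards [hequi', hcone', hlow', hf1, hf2] with ω hω1 hω2 hω3 hω4 hω5
  intro n hn
  have hn' : (1 : ℝ) ≤ n := by exact_mod_cast hn
  have hn0 : (0 : ℝ) < n := by linarith
  constructor
  · simp_rw [← Scount_eq] at hω4 hω5
    have hN := Neps_spec β γ b ε σ σinv ω hω4 hω5
    set N := Neps β γ b ε σ σinv ω with hNdef
    have hN1 : (1 : ℝ) ≤ (N : ℝ) + 1 := by
      have : (0 : ℝ) ≤ N := by positivity
      linarith
    have hnpow : 0 < (n : ℝ) ^ (1 - 1 / γ) := Real.rpow_pos_of_pos hn0 _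
    rcases le_or_gt n N with hnN | hnN
    · -- trivial regime
      have h1 : (μ ω {x | (n : ℕ∞) ≤ hitTime σ T ω x}).toReal ≤ 1 :=
        measureReal_le_one
      refine h1.trans ?_
      have h2 : (1 : ℝ) ≤ ((N : ℝ) + 1) ^ (1 / γ - 1) * (n : ℝ) ^ (1 - 1 / γ) := by
        rw [show 1 - 1 / γ = -(1 / γ - 1) by ring, Real.rpow_neg hn0.le, ← div_eq_mul_inv,
          one_le_div (Real.rpow_pos_of_pos hn0 _)]
        apply Real.rpow_le_rpow hn0.le _ (by linarith)
        have : (n : ℝ) ≤ N := by exact_mod_cast hnN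
        linarith
      have h3 : ((N : ℝ) + 1) ^ (1 / γ - 1) ≤ ((N : ℝ) + 1) ^ (max 1 (1 / γ - 1)) :=
        Real.rpow_le_rpow_of_exponent_le hN1 (le_max_right _ _)
      have h4 : (1 : ℝ) ≤ ((N : ℝ) + 1) ^ (max 1 (1 / γ - 1)) * (n : ℝ) ^ (1 - 1 / γ) :=
        h2.trans (by gcongr)
      rw [mul_assoc]
      nlinarith
    · have hS : ∀ k : ℕ, b / 4 * ((n : ℝ) + k) ≤ Scount β γ σ (n + k) (σinv^[k] ω) := by
        intro k
        have hk0 : (0 : ℝ) ≤ k := by positivity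
        rcases le_or_gt n k with hk | hk
        · have h1 := (hN (k + 1) (by omega)).2
          rw [Scount_back' β γ σ σinv hinv₂] at h1
          have h2 : (Scount β γ σ (k + 1) (σinv^[k] ω) : ℝ) ≤
              Scount β γ σ (n + k) (σinv^[k] ω) := by
            exact_mod_cast Scount_mono β γ σ _ (by omega)
          refine le_trans ?_ (h1.trans h2)
          have h3 : (n : ℝ) ≤ k := by exact_mod_cast hk
          push_cast
          have h4 : b * (1 / 2) ≤ b * (1 - ε) := by gcongr; linarith
          have h5 : ((k : ℝ) + 1) * (b * (1 / 2)) ≤ ((k : ℝ) + 1) * (b * (1 - ε)) := by gcongr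
          nlinarith
        · have h1 := (hN n hnN).1
          have h2 : (Scount β γ σ n ω : ℝ) ≤ Scount β γ σ (n + k) (σinv^[k] ω) := by
            exact_mod_cast Scount_back β γ σ σinv hinv₂ n ω k
          refine le_trans ?_ (h1.trans h2)
          have h3 : (k : ℝ) ≤ n := by exact_mod_cast hk.le
          have h4 : b * (1 / 2) ≤ b * (1 - ε) := by gcongr; linarith
          have h5 : (n : ℝ) * (b * (1 / 2)) ≤ (n : ℝ) * (b * (1 - ε)) := by gcongr
          nlinarith
      have hmain := tail_core σ σinv hinv₂ β hβ hγ0 hγ1 T hTdef h μ hμdef hμprob acone (1 - βsup)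
        (by linarith) ω hω1 (fun k => (hω2 k).1) (fun k => (hω2 k).2.1)
        (fun k x hx => hc.le.trans (hω3 k x hx)) (fun k => (hω2 k).2.2.2) n hn (b / 4)
        (by linarith) hS
      have h1 : (μ ω {x | (n : ℕ∞) ≤ hitTime σ T ω x}).toReal ≤ C1 * (n : ℝ) ^ (1 - 1 / γ) :=
        ENNReal.toReal_le_of_le_ofReal (by positivity) hmain
      refine h1.trans ?_
      gcongr
      have h2 : (1 : ℝ) ≤ ((N : ℝ) + 1) ^ (max 1 (1 / γ - 1)) :=
        Real.one_le_rpow hN1 (le_trans zero_le_one (le_max_left _ _))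
      nlinarith
  · rcases Nat.eq_zero_or_pos (Scount β γ σ n ω) with h0 | h0
    · rw [h0, Nat.cast_zero, ENNReal.zero_rpow_of_neg (by linarith), ENNReal.mul_top]
      · exact le_top
      · simp only [ne_eq, ENNReal.ofReal_eq_zero, not_le]; positivity
    · have hs : (0 : ℝ) < Scount β γ σ n ω := by exact_mod_cast h0
      have hv := Yhit_volume σ β hβ hγ0 hγ1 T hTdef n hn ω _ hs le_rfl
      rw [Measure.smul_apply, smul_eq_mul, Measure.restrict_apply' measurableSet_Icc, inter_comm]
      refine hv.trans ?_
      rw [ENNReal.ofReal_mul hD0.le, ← ENNReal.ofReal_rpow_of_pos hs, ENNReal.ofReal_natCast]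
      gcongr
      linarith

end
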